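/- arXiv:2109.04805 — 2 statements merged into one kernel-verified Lean document; each statement's English description precedes it below -/
import Mathlib

section
/- Let X be a set, F a field, d a positive integer, and f : X → F^d linearly independent (the component functions f_0,...,f_{d-1} are linearly independent in the F-vector space of functions X → F). Then the VC shatter function of C_f = {Z_{f,a} : a ∈ F^d, a ≠ 0} evaluated at d equals 2^d − 1; that is, the maximum over d-element subsets Y ⊆ X of the number of distinct traces {A ∩ Y : A ∈ C_f} equals 2^d − 1. -/
/-- The zero set of the linear combination of the components of `f` with coefficients `a`. -/
def zeroSet {X F : Type*} [Field F] {d : ℕ} (f : X → Fin d → F) (a : Fin d → F) : Set X :=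
  {c | ∑ i, a i * f c i = 0}

/-- The family of zero sets of nontrivial linear combinations of the components of `f`. -/
def zeroSets {X F : Type*} [Field F] {d : ℕ} (f : X → Fin d → F) : Set (Set X) :=
  {s | ∃ a : Fin d → F, a ≠ 0 ∧ s = zeroSet f a}

/-- The set of traces of members of `C` on `Y`. -/
def traces {X : Type*} (C : Set (Set X)) (Y : Set X) : Set (Set X) :=
  (fun A => A ∩ Y) '' C

theorem mem_zeroSet_iff {X F : Type*} [Field F] {d : ℕ} {f : X → Fin d → F} {a : Fin d → F}
    {x : X} : x ∈ zeroSet f a ↔ dotProductEquiv F (Fin d) a (f x) = 0 :=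
  Iff.rfl

theorem traces_subset_powerset {X : Type*} (C : Set (Set X)) (Y : Set X) :
    traces C Y ⊆ 𝒫 Y := by
  rintro _ ⟨A, -, rfl⟩
  exact Set.inter_subset_right

theorem ncard_powerset_diff_singleton {X : Type*} {Y : Finset X} {n : ℕ} (hY : Y.card = n)
    {B : Set X} (hB : B ⊆ Y) : (𝒫 (Y : Set X) \ {B}).ncard = 2 ^ n - 1 := by
  rw [Set.ncard_sdiff_singleton_of_mem (Set.mem_powerset hB), Set.ncard_powerset _ Y.finite_toSet,
    Set.ncard_coe_finset, hY]

/-- Linearly independent component functions have values spanning the whole space. -/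
theorem span_range_eq_top_of_linearIndependent {X F : Type*} [Field F] {d : ℕ}
    {f : X → Fin d → F} (hf : LinearIndependent F (fun i : Fin d => fun x : X => f x i)) :
    Submodule.span F (Set.range f) = ⊤ := by
  by_contra h
  obtain ⟨φ, hφ, hle⟩ := Submodule.exists_le_ker_of_lt_top _ (lt_top_iff_ne_top.2 h)
  obtain ⟨a, rfl⟩ := (dotProductEquiv F (Fin d)).surjective φ
  have ha : a = 0 := by
    refine funext (Fintype.linearIndependent_iff.1 hf a ?_)
    ext x
    have hx : dotProductEquiv F (Fin d) a (f x) = 0 := hle (Submodule.subset_span ⟨x, rfl⟩)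
    simpa [dotProduct] using hx
  exact hφ (by simp [ha])

/-- Values of `f` spanning the whole space contain a basis indexed by a `d`-element subset. -/
theorem exists_finset_linearIndepOn {X F : Type*} [Field F] {d : ℕ} {f : X → Fin d → F}
    (hf : Submodule.span F (Set.range f) = ⊤) :
    ∃ Y : Finset X, Y.card = d ∧ LinearIndepOn F f (Y : Set X) := by
  obtain ⟨κ, g, hg, hspan, hli⟩ := exists_linearIndependent' F f
  have : Finite κ := LinearIndependent.finite hli
  have : Fintype κ := Fintype.ofFinite κ
  refine ⟨Finset.univ.map ⟨g, hg⟩, ?_, ?_⟩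
  · have hcard := Module.finrank_eq_card_basis (Module.Basis.mk hli (by rw [hspan, hf]))
    simpa using hcard.symm
  · have := (linearIndepOn_range_iff hg f).2 hli
    simpa using this

/-- No nonzero linear form vanishes on `d` linearly independent vectors of `F^d`. -/
theorem notMem_traces_of_linearIndepOn {X F : Type*} [Field F] {d : ℕ} {f : X → Fin d → F}
    {Y : Finset X} (hY : Y.card = d) (hli : LinearIndepOn F f (Y : Set X)) :
    (Y : Set X) ∉ traces (zeroSets f) Y := by
  rintro ⟨_, ⟨a, ha, rfl⟩, hA⟩
  have hspan : Submodule.span F (Set.range fun y : Y => f y) = ⊤ :=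
    LinearIndependent.span_eq_top_of_card_eq_finrank' hli (by simp [hY])
  refine ha ((dotProductEquiv F (Fin d)).map_eq_zero_iff.1 (LinearMap.ext_on_range hspan ?_))
  intro y
  exact mem_zeroSet_iff.1 (Set.inter_eq_right.1 hA y.2)

/-- If some value of `f` on `Y` lies in the span of the others, then the complement of the
corresponding point is not a trace. -/
theorem diff_singleton_notMem_traces {X F : Type*} [Field F] {d : ℕ} {f : X → Fin d → F}
    {Y : Set X} {y : X} (hy : y ∈ Y) (hspan : f y ∈ Submodule.span F (f '' (Y \ {y}))) :
    Y \ {y} ∉ traces (zeroSets f) Y := by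
  rintro ⟨_, ⟨a, -, rfl⟩, hA : zeroSet f a ∩ Y = Y \ {y}⟩
  have hle : Submodule.span F (f '' (Y \ {y})) ≤ (dotProductEquiv F (Fin d) a).ker := by
    rw [Submodule.span_le]
    rintro _ ⟨x, hx, rfl⟩
    exact mem_zeroSet_iff.1 (hA.symm.subset hx).1
  exact (hA.subset ⟨mem_zeroSet_iff.2 (hle hspan), hy⟩).2 rfl

/-- Every proper subset of a set on which `f` is linearly independent is a trace. -/
theorem mem_traces_of_ssubset {X F : Type*} [Field F] {d : ℕ} {f : X → Fin d → F}
    {Y B : Set X} (hli : LinearIndepOn F f Y) (hB : B ⊂ Y) : B ∈ traces (zeroSets f) Y := by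
  classical
  obtain ⟨φ, hφ⟩ : ∃ φ : Module.Dual F (Fin d → F),
      ∀ y : Y, φ (f y) = if ↑y ∈ B then 0 else 1 := by
    have hliY : LinearIndependent F fun y : Y => f y := hli
    obtain ⟨φ, hφ⟩ := LinearMap.exists_extend
      ((Module.Basis.span hliY).constr F fun y : Y => if ↑y ∈ B then (0 : F) else 1)
    refine ⟨φ, fun y => ?_⟩
    have := LinearMap.congr_fun hφ (Module.Basis.span hliY y)
    rw [Module.Basis.constr_basis] at this
    rw [← this, LinearMap.comp_apply, Submodule.subtype_apply, Module.Basis.span_apply]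
  obtain ⟨a, rfl⟩ := (dotProductEquiv F (Fin d)).surjective φ
  obtain ⟨z, hzY, hzB⟩ := Set.exists_of_ssubset hB
  refine ⟨zeroSet f a, ⟨a, ?_, rfl⟩, ?_⟩
  · rintro rfl
    simpa [hzB] using hφ ⟨z, hzY⟩
  · ext x
    refine ⟨fun ⟨hx, hxY⟩ => ?_, fun hx => ⟨?_, hB.1 hx⟩⟩
    · by_contra hxB
      have := hφ ⟨x, hxY⟩
      rw [mem_zeroSet_iff.1 hx, if_neg hxB] at this
      exact zero_ne_one this
    · rw [mem_zeroSet_iff, hφ ⟨x, hB.1 hx⟩, if_pos hx]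

/-- If the component functions of `f : X → F^d` are linearly independent,
then the VC shatter function of `C_f` at `d` equals `2^d - 1`: the maximum over
`d`-element subsets `Y ⊆ X` of the number of traces of `C_f` on `Y` is `2^d - 1`. -/
theorem statement5 {X F : Type*} [Field F] {d : ℕ} (hd : 0 < d) (f : X → Fin d → F)
    (hf : LinearIndependent F (fun i : Fin d => fun x : X => f x i)) :
    (∃ Y : Finset X, Y.card = d ∧ (traces (zeroSets f) ↑Y).ncard = 2 ^ d - 1) ∧
    (∀ Y : Finset X, Y.card = d → (traces (zeroSets f) ↑Y).ncard ≤ 2 ^ d - 1) := by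
  constructor
  · obtain ⟨Y, hY, hli⟩ := exists_finset_linearIndepOn (span_range_eq_top_of_linearIndependent hf)
    refine ⟨Y, hY, ?_⟩
    rw [← ncard_powerset_diff_singleton hY subset_rfl]
    congr 1
    refine subset_antisymm (fun B hB => ⟨traces_subset_powerset _ _ hB, ?_⟩) fun B hB =>
      mem_traces_of_ssubset hli (Set.ssubset_iff_subset_ne.2 hB)
    rintro rfl
    exact notMem_traces_of_linearIndepOn hY hli hB
  · intro Y hY
    obtain ⟨B, hBY, hB⟩ : ∃ B ⊆ (Y : Set X), B ∉ traces (zeroSets f) Y := by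
      by_cases hli : LinearIndepOn F f (Y : Set X)
      · exact ⟨Y, subset_rfl, notMem_traces_of_linearIndepOn hY hli⟩
      · rw [linearIndepOn_iff_notMem_span] at hli
        push Not at hli
        obtain ⟨y, hy, hspan⟩ := hli
        exact ⟨_, Set.sdiff_subset, diff_singleton_notMem_traces hy hspan⟩
    rw [← ncard_powerset_diff_singleton hY hBY]
    exact Set.ncard_le_ncard
      (fun A hA => ⟨traces_subset_powerset _ _ hA, fun h => hB (h ▸ hA)⟩)
      Y.finite_toSet.powerset.sdiff
end

section
/- Let X be a set, F a field, d ≥ 2 an integer, and f : X → F^d. Then the following are equivalent: (1) C_f = {Z_{f,a} : a ∈ F^d, a ≠ 0} is maximal of VC-dimension d − 1, i.e., for every n ≥ d − 1 there is an n-element subset Y ⊆ X with |{A ∩ Y : A ∈ C_f}| = Σ_{i=0}^{d-1} C(n, i); (2) f(X) is not contained in any finite union of proper linear subspaces of F^d. -/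
theorem mem_zeroSets_iff_exists_dual {X F : Type*} [Field F] {d : ℕ} {f : X → Fin d → F}
    {s : Set X} :
    s ∈ zeroSets f ↔ ∃ φ : Module.Dual F (Fin d → F), φ ≠ 0 ∧ s = {c | φ (f c) = 0} := by
  constructor
  · rintro ⟨a, ha, rfl⟩
    exact ⟨dotProductEquiv F (Fin d) a, by simpa using ha, rfl⟩
  · rintro ⟨φ, hφ, rfl⟩
    obtain ⟨a, rfl⟩ := (dotProductEquiv F (Fin d)).surjective φ
    exact ⟨a, by simpa using hφ, rfl⟩

/-- The subsets of `Y` with fewer than `d` elements. -/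
def smallSubsets {X : Type*} [DecidableEq X] (d : ℕ) (Y : Finset X) : Finset (Finset X) :=
  (Finset.range d).biUnion fun i => Y.powersetCard i

theorem mem_smallSubsets {X : Type*} [DecidableEq X] {d : ℕ} {Y B : Finset X} :
    B ∈ smallSubsets d Y ↔ B ⊆ Y ∧ B.card < d := by
  simp [smallSubsets, Finset.mem_powersetCard, and_comm]

theorem card_smallSubsets {X : Type*} [DecidableEq X] (d : ℕ) (Y : Finset X) :
    (smallSubsets d Y).card = ∑ i ∈ Finset.range d, Y.card.choose i := by
  rw [smallSubsets, Finset.card_biUnion fun i _ j _ hij => Y.pairwise_disjoint_powersetCard hij]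
  simp

theorem finrank_span_image_of_linearIndepOn {X F V : Type*} [Field F] [AddCommGroup V]
    [Module F V] {f : X → V} {B : Finset X} (h : LinearIndepOn F f (B : Set X)) :
    Module.finrank F (Submodule.span F (f '' B)) = B.card := by
  rw [Set.image_eq_range]
  simpa using finrank_span_eq_card h

theorem span_image_ne_top_of_card_lt {X F : Type*} [Field F] {d : ℕ} (f : X → Fin d → F)
    {B : Finset X} (h : B.card < d) : Submodule.span F (f '' B) ≠ ⊤ := by
  classical
  intro htop
  have h1 := finrank_span_finset_le_card (R := F) (B.image f)
  rw [Set.finrank, Finset.coe_image, htop, finrank_top, Module.finrank_fin_fun] at h1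
  exact absurd (h1.trans Finset.card_image_le) (by omega)

/-- A trace on `Y` is cut out by the span of a linearly independent family of fewer than `d` of
its points. -/
theorem exists_basis_of_mem_traces {X F : Type*} [Field F] {d : ℕ} {f : X → Fin d → F}
    {Y : Finset X} {A : Set X} (hA : A ∈ traces (zeroSets f) Y) :
    ∃ B : Finset X, B ⊆ Y ∧ B.card < d ∧ LinearIndepOn F f (B : Set X) ∧
      A = {y | y ∈ Y ∧ f y ∈ Submodule.span F (f '' B)} := by
  obtain ⟨_, hs, rfl⟩ := hA
  obtain ⟨φ, hφ, rfl⟩ := mem_zeroSets_iff_exists_dual.1 hs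
  obtain ⟨b, hbA, -, hspan, hb⟩ := exists_linearIndepOn_extension (linearIndepOn_empty F f)
    (Set.empty_subset ({c | φ (f c) = 0} ∩ (Y : Set X)))
  obtain ⟨B, rfl⟩ := ((Y.finite_toSet.inter_of_right _).subset hbA).exists_finset_coe
  have hker : Submodule.span F (f '' B) ≤ LinearMap.ker φ := by
    rw [Submodule.span_le]
    rintro _ ⟨c, hc, rfl⟩
    exact (hbA hc).1
  refine ⟨B, fun x hx => (hbA hx).2, ?_, hb, ?_⟩
  · rw [← finrank_span_image_of_linearIndepOn hb]
    have hne : Submodule.span F (f '' B) ≠ ⊤ := fun htop =>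
      hφ (LinearMap.ker_eq_top.1 (top_le_iff.1 (htop ▸ hker)))
    simpa using Submodule.finrank_lt hne
  · ext y
    exact ⟨fun hy => ⟨hy.2, hspan ⟨y, hy, rfl⟩⟩, fun hy => ⟨hker hy.2, hy.1⟩⟩

/-- If `Y` carries the maximal number of traces, a proper subspace contains the images of fewer
than `d` points of `Y`. -/
theorem card_lt_of_ncard_traces_eq {X F : Type*} [Field F] {d : ℕ} (hd : 2 ≤ d)
    {f : X → Fin d → F} {Y : Finset X}
    (hY : (traces (zeroSets f) ↑Y).ncard = ∑ i ∈ Finset.range d, Y.card.choose i)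
    {V : Submodule F (Fin d → F)} (hV : V ≠ ⊤) {D : Finset X} (hDY : D ⊆ Y)
    (hDV : ∀ x ∈ D, f x ∈ V) : D.card < d := by
  classical
  by_contra! hD
  obtain ⟨E, hED, hE⟩ := Finset.exists_subset_card_eq hD
  choose! g hgY hgc hgi hgA using fun A (hA : A ∈ traces (zeroSets f) Y) =>
    exists_basis_of_mem_traces hA
  have hinj : Set.InjOn g (traces (zeroSets f) Y) := fun A hA A' hA' h => by
    rw [hgA A hA, hgA A' hA', h]
  have himage : g '' traces (zeroSets f) Y = smallSubsets d Y := by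
    apply Set.eq_of_subset_of_ncard_le
    · rintro _ ⟨A, hA, rfl⟩
      exact mem_smallSubsets.2 ⟨hgY A hA, hgc A hA⟩
    · rw [hinj.ncard_image, hY, Set.ncard_coe_finset, card_smallSubsets]
    · exact Finset.finite_toSet _
  have herase : ∀ x ∈ E, ∃ A ∈ traces (zeroSets f) Y, g A = E.erase x ∧
      A = {y | y ∈ Y ∧ f y ∈ V} := by
    intro x hx
    have hcard : (E.erase x).card = d - 1 := by rw [Finset.card_erase_of_mem hx, hE]
    have hmem : E.erase x ∈ g '' traces (zeroSets f) Y := by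
      rw [himage]
      exact mem_smallSubsets.2
        ⟨((E.erase_subset x).trans hED).trans hDY, by omega⟩
    obtain ⟨A, hA, hgx⟩ := hmem
    refine ⟨A, hA, hgx, ?_⟩
    have hspan : Submodule.span F (f '' (g A : Set X)) = V := by
      apply Submodule.eq_of_le_of_finrank_le
      · rw [Submodule.span_le]
        rintro _ ⟨c, hc, rfl⟩
        rw [hgx] at hc
        exact hDV c (hED (E.erase_subset x hc))
      · rw [finrank_span_image_of_linearIndepOn (hgi A hA), hgx, hcard]
        have := Submodule.finrank_lt hV
        rw [Module.finrank_fin_fun] at this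
        omega
    rw [← hspan]
    exact hgA A hA
  obtain ⟨x, hx, y, hy, hxy⟩ := Finset.one_lt_card.1 (show 1 < E.card by omega)
  obtain ⟨A, hA, hgx, hAV⟩ := herase x hx
  obtain ⟨A', hA', hgy, hAV'⟩ := herase y hy
  have heq : E.erase x = E.erase y := by rw [← hgx, ← hgy, hAV, hAV']
  exact Finset.notMem_erase x E (heq ▸ Finset.mem_erase.2 ⟨hxy, hx⟩)

theorem exists_forall_notMem_of_not_covered {X F : Type*} [Field F] {d : ℕ} {f : X → Fin d → F}
    (h : ¬ ∃ (k : ℕ) (V : Fin k → Submodule F (Fin d → F)),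
      (∀ i, V i ≠ ⊤) ∧ ∀ x : X, ∃ i, f x ∈ V i)
    {ι : Type*} [Finite ι] (V : ι → Submodule F (Fin d → F)) (hV : ∀ i, V i ≠ ⊤) :
    ∃ x, ∀ i, f x ∉ V i := by
  by_contra! hcov
  obtain ⟨k, ⟨e⟩⟩ := Finite.exists_equiv_fin ι
  refine h ⟨k, V ∘ e.symm, fun i => hV _, fun x => ?_⟩
  obtain ⟨i, hi⟩ := hcov x
  exact ⟨e i, by simpa using hi⟩

theorem infinite_of_not_covered {X F : Type*} [Field F] {d : ℕ} (hd : 2 ≤ d) {f : X → Fin d → F}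
    (h : ¬ ∃ (k : ℕ) (V : Fin k → Submodule F (Fin d → F)),
      (∀ i, V i ≠ ⊤) ∧ ∀ x : X, ∃ i, f x ∈ V i) : Infinite F := by
  by_contra hfin
  rw [not_infinite_iff_finite] at hfin
  obtain ⟨x, hx⟩ := exists_forall_notMem_of_not_covered h
    (fun v : Fin d → F => Submodule.span F {v}) fun v => by
      simpa using span_image_ne_top_of_card_lt (id : (Fin d → F) → _) (B := {v})
        (by rw [Finset.card_singleton]; omega)
  exact hx (f x) (Submodule.mem_span_singleton_self _)

/-- There are arbitrarily large finite sets whose images under `f` are in general position. -/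
theorem exists_generalPosition {X F : Type*} [Field F] {d : ℕ} (hd : 2 ≤ d) {f : X → Fin d → F}
    (h : ¬ ∃ (k : ℕ) (V : Fin k → Submodule F (Fin d → F)),
      (∀ i, V i ≠ ⊤) ∧ ∀ x : X, ∃ i, f x ∈ V i) (n : ℕ) :
    ∃ Y : Finset X, Y.card = n ∧
      ∀ B ⊆ Y, B.card ≤ d → LinearIndepOn F f (B : Set X) := by
  classical
  induction n with
  | zero => exact ⟨∅, rfl, fun B hB _ => by simp [Finset.subset_empty.1 hB]⟩
  | succ n ih =>
    obtain ⟨Y, hY, hind⟩ := ih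
    obtain ⟨x, hx⟩ := exists_forall_notMem_of_not_covered h
      (fun B : smallSubsets d Y => Submodule.span F (f '' (B : Finset X)))
      fun B => span_image_ne_top_of_card_lt f (mem_smallSubsets.1 B.2).2
    replace hx : ∀ B ⊆ Y, B.card < d → f x ∉ Submodule.span F (f '' (B : Set X)) :=
      fun B hB hc => hx ⟨B, mem_smallSubsets.2 ⟨hB, hc⟩⟩
    have hxY : x ∉ Y := fun hxY => hx {x} (by simpa using hxY)
      (by rw [Finset.card_singleton]; omega) (Submodule.subset_span (by simp))
    refine ⟨insert x Y, by rw [Finset.card_insert_of_notMem hxY, hY], fun B hB hc => ?_⟩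
    by_cases hxB : x ∈ B
    · have hsub : B.erase x ⊆ Y := Finset.subset_insert_iff.1 hB
      have hlt : (B.erase x).card < d := (Finset.card_erase_lt_of_mem hxB).trans_le hc
      rw [← Finset.insert_erase hxB, Finset.coe_insert]
      exact (hind _ hsub hlt.le).insert (hx _ hsub hlt)
    · exact hind B ((Finset.subset_insert_iff_of_notMem hxB).1 hB) hc

theorem traces_eq_of_generalPosition {X F : Type*} [Field F] [Infinite F] [DecidableEq X] {d : ℕ}
    {f : X → Fin d → F} {Y : Finset X}
    (hY : ∀ B ⊆ Y, B.card ≤ d → LinearIndepOn F f (B : Set X)) :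
    traces (zeroSets f) Y = (fun B : Finset X => (B : Set X)) '' smallSubsets d Y := by
  have hnotMem : ∀ B ⊆ Y, B.card < d → ∀ y ∈ Y, y ∉ B →
      f y ∉ Submodule.span F (f '' (B : Set X)) := by
    intro B hB hc y hy hyB
    refine LinearIndepOn.notMem_span_of_insert ?_ (by simpa using hyB)
    rw [← Finset.coe_insert]
    exact hY _ (Finset.insert_subset hy hB) (by rw [Finset.card_insert_of_notMem hyB]; omega)
  apply Set.Subset.antisymm
  · intro A hA
    obtain ⟨B, hB, hc, -, rfl⟩ := exists_basis_of_mem_traces hA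
    refine ⟨B, mem_smallSubsets.2 ⟨hB, hc⟩, ?_⟩
    ext y
    refine ⟨fun hy => ⟨hB hy, Submodule.subset_span ⟨y, hy, rfl⟩⟩, fun hy => ?_⟩
    by_contra hyB
    exact hnotMem B hB hc y hy.1 hyB hy.2
  · rintro _ ⟨B, hB, rfl⟩
    obtain ⟨hBY, hc⟩ := mem_smallSubsets.1 hB
    let W := Submodule.span F (f '' (B : Set X))
    obtain ⟨v, hv⟩ : ∃ v, v ∉ W := by
      by_contra! hW
      exact span_image_ne_top_of_card_lt f hc (Submodule.eq_top_iff'.2 hW)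
    obtain ⟨ψ, hψ⟩ := Module.exists_dual_forall_apply_ne_zero (K := F)
      (fun o : Option {y // y ∈ Y \ B} => W.mkQ (o.elim v fun y => f y)) (by
        rintro (_ | ⟨y, hy⟩)
        · simpa using hv
        · rw [Finset.mem_sdiff] at hy
          simpa using hnotMem B hBY hc y hy.1 hy.2)
    refine ⟨{c | ψ (W.mkQ (f c)) = 0}, mem_zeroSets_iff_exists_dual.2
      ⟨ψ ∘ₗ W.mkQ, fun h0 => hψ none (LinearMap.congr_fun h0 v), rfl⟩, ?_⟩
    ext y
    constructor
    · rintro ⟨hy, hyY⟩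
      by_contra hyB
      exact hψ (some ⟨y, Finset.mem_sdiff.2 ⟨hyY, hyB⟩⟩) hy
    · intro hy
      have hyW : W.mkQ (f y) = 0 := by
        simpa using (Submodule.subset_span ⟨y, hy, rfl⟩ : f y ∈ W)
      exact ⟨by simp only [Set.mem_ofPred_eq, hyW, map_zero], hBY hy⟩

/-- `C_f` is maximal of VC-dimension `d - 1` (for every `n ≥ d - 1` some
`n`-element subset carries exactly `∑_{i=0}^{d-1} (n choose i)` traces) if and only if
the image of `f` is not contained in any finite union of proper linear subspaces of
`F^d`. -/
theorem statement15 {X F : Type*} [Field F] {d : ℕ} (hd : 2 ≤ d) (f : X → Fin d → F) :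
    (∀ n : ℕ, d - 1 ≤ n → ∃ Y : Finset X, Y.card = n ∧
      (traces (zeroSets f) ↑Y).ncard = ∑ i ∈ Finset.range d, n.choose i) ↔
    ¬ ∃ (k : ℕ) (V : Fin k → Submodule F (Fin d → F)),
      (∀ i, V i ≠ ⊤) ∧ ∀ x : X, ∃ i, f x ∈ V i := by
  classical
  constructor
  · rintro hmax ⟨k, V, hV, hcov⟩
    choose i hi using hcov
    obtain ⟨Y, hYcard, hY⟩ := hmax (k * d + d) (by omega)
    obtain ⟨j, -, hj⟩ := Finset.exists_lt_card_fiber_of_mul_lt_card_of_maps_to (s := Y)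
      (t := Finset.univ) (f := i) (n := d) (fun _ _ => Finset.mem_univ _) (by
        rw [Finset.card_univ, Fintype.card_fin, hYcard]; omega)
    rw [← hYcard] at hY
    refine hj.not_gt (card_lt_of_ncard_traces_eq hd hY (hV j) (Finset.filter_subset _ _) ?_)
    intro x hx
    rw [← (Finset.mem_filter.1 hx).2]
    exact hi x
  · intro h n _
    have := infinite_of_not_covered hd h
    obtain ⟨Y, rfl, hY⟩ := exists_generalPosition hd h n
    refine ⟨Y, rfl, ?_⟩
    rw [traces_eq_of_generalPosition hY, Set.ncard_image_of_injective _ Finset.coe_injective,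
      Set.ncard_coe_finset, card_smallSubsets]
end
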